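/- Let X be a compact metric space and f : X → X a continuous map. Let x, y ∈ X with x ∈ W^s(C), y ∈ W^s(C') for chain components C ≠ C' of f. Then (x, y) is a distal pair for f, i.e., liminf_{i→∞} d(f^i(x), f^i(y)) > 0. Equivalently, every proximal pair (x,y) for f (liminf_{i→∞} d(f^i(x), f^i(y)) = 0) with x ∈ W^s(C) and y ∈ W^s(C') satisfies C = C'. -/

import Mathlib

open Filter Metric Set Topology

section Defs

variable {X : Type*} [MetricSpace X]

/-- A δ-chain of `f` of length `k` (with `k ≥ 1`) within the set `C`, from `x` to `y`. -/
def ChainIn (f : X → X) (C : Set X) (δ : ℝ) (k : ℕ) (x y : X) : Prop :=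
  1 ≤ k ∧ ∃ c : ℕ → X, c 0 = x ∧ c k = y ∧ (∀ i ≤ k, c i ∈ C) ∧
    ∀ i < k, dist (f (c i)) (c (i + 1)) ≤ δ

/-- `x → y` : for every `δ > 0` there is a `δ`-chain of `f` from `x` to `y`. -/
def ChainReach (f : X → X) (x y : X) : Prop :=
  ∀ δ > 0, ∃ k, ChainIn f Set.univ δ k x y

/-- `x` is chain recurrent for `f`. -/
def ChainRecurrent (f : X → X) (x : X) : Prop := ChainReach f x x

/-- `C` is a chain component of `f`: an equivalence class of the relation `↔`
on the set of chain recurrent points. -/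
def IsChainComponent (f : X → X) (C : Set X) : Prop :=
  ∃ x, ChainRecurrent f x ∧
    C = {y | ChainRecurrent f y ∧ ChainReach f x y ∧ ChainReach f y x}

/-- The set of lengths of δ-cycles of `f` restricted to `C`. -/
def cycleLengths (f : X → X) (C : Set X) (δ : ℝ) : Set ℕ :=
  {k | ∃ x ∈ C, ChainIn f C δ k x x}

/-- The greatest common divisor of a set of natural numbers
(the greatest natural number dividing every element). -/
noncomputable def setGcd (S : Set ℕ) : ℕ := sSup {d | ∀ k ∈ S, d ∣ k}

/-- `x ∼_{C,δ} y` : there is a δ-chain of `f|_C` from `x` to `y` whose length is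
divisible by `m(C,δ)`, the gcd of the lengths of all δ-cycles of `f|_C`. -/
def SimCd (f : X → X) (C : Set X) (δ : ℝ) (x y : X) : Prop :=
  ∃ k, setGcd (cycleLengths f C δ) ∣ k ∧ ChainIn f C δ k x y

/-- `x ∼_C y` : `x ∼_{C,δ} y` for all `δ > 0`. -/
def SimC (f : X → X) (C : Set X) (x y : X) : Prop :=
  ∀ δ > 0, SimCd f C δ x y

/-- `𝒟(C,δ)` : the set of equivalence classes of `∼_{C,δ}`. -/
def DClassesd (f : X → X) (C : Set X) (δ : ℝ) : Set (Set X) :=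
  {D | ∃ x ∈ C, D = {y ∈ C | SimCd f C δ x y}}

/-- `𝒟(C)` : the set of equivalence classes of `∼_C`. -/
def DClasses (f : X → X) (C : Set X) : Set (Set X) :=
  {D | ∃ x ∈ C, D = {y ∈ C | SimC f C x y}}

/-- `W^s(C) = {x : lim_{i→∞} d(f^i(x), C) = 0}`. -/
def wStable (f : X → X) (C : Set X) : Set X :=
  {x | Tendsto (fun i => infDist (f^[i] x) C) atTop (nhds 0)}

/-- `V^s(D) = ⋂_{δ>0} {x ∈ W^s(C) : lim_{i→∞} d(f^i(x), f^i(D_δ)) = 0}`, where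
`D_δ` is the unique element of `𝒟(C,δ)` containing `D`. -/
def vStable (f : X → X) (C D : Set X) : Set X :=
  {x | x ∈ wStable f C ∧ ∀ δ > 0, ∀ Dd ∈ DClassesd f C δ, D ⊆ Dd →
    Tendsto (fun i => infDist (f^[i] x) (f^[i] '' Dd)) atTop (nhds 0)}

/-- The s-limit shadowing property. -/
def SLimitShadowing (f : X → X) : Prop :=
  ∀ ε > 0, ∃ δ > 0, ∀ x : ℕ → X,
    (∀ i, dist (f (x i)) (x (i + 1)) ≤ δ) →
    Tendsto (fun i => dist (f (x i)) (x (i + 1))) atTop (nhds 0) →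
    ∃ z : X, (∀ i, dist (f^[i] z) (x i) ≤ ε) ∧
      Tendsto (fun i => dist (f^[i] z) (x i)) atTop (nhds 0)

/-- The limit shadowing property. -/
def LimitShadowing (f : X → X) : Prop :=
  ∀ x : ℕ → X, Tendsto (fun i => dist (f (x i)) (x (i + 1))) atTop (nhds 0) →
    ∃ z : X, Tendsto (fun i => dist (f^[i] z) (x i)) atTop (nhds 0)

/-- The (plain) shadowing property. -/
def ShadowingProperty (f : X → X) : Prop :=
  ∀ ε > 0, ∃ δ > 0, ∀ x : ℕ → X, (∀ i, dist (f (x i)) (x (i + 1)) ≤ δ) →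
    ∃ z : X, ∀ i, dist (f^[i] z) (x i) ≤ ε

/-- A Furstenberg family: hereditary upward and proper. -/
def FurstenbergFamily (F : Set (Set ℕ)) : Prop :=
  (∀ A B : Set ℕ, A ∈ F → A ⊆ B → B ∈ F) ∧ F.Nonempty ∧ F ≠ Set.univ

/-- A full Furstenberg family. -/
def FullFamily (F : Set (Set ℕ)) : Prop :=
  ∀ A ∈ F, ∀ n : ℕ, {i ∈ A | n ≤ i} ∈ F

/-- A translation invariant Furstenberg family. -/
def TranslationInvariantFamily (F : Set (Set ℕ)) : Prop :=
  ∀ A ∈ F, ∀ n : ℕ, ((fun i => i + n) '' A ∈ F ∧ {i | i + n ∈ A} ∈ F)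

/-- `S_f(x₁,…,xₙ; r) = {i : min_{j<k} d(fⁱ(x_j), fⁱ(x_k)) > r}`. -/
def Sset (f : X → X) {n : ℕ} (x : Fin n → X) (r : ℝ) : Set ℕ :=
  {i | ∀ j k : Fin n, j < k → r < dist (f^[i] (x j)) (f^[i] (x k))}

/-- `T_f(x₁,…,xₙ; r) = {i : max_{j<k} d(fⁱ(x_j), fⁱ(x_k)) < r}`. -/
def Tset (f : X → X) {n : ℕ} (x : Fin n → X) (r : ℝ) : Set ℕ :=
  {i | ∀ j k : Fin n, j < k → dist (f^[i] (x j)) (f^[i] (x k)) < r}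

/-- `(x₁,…,xₙ)` is an `(ℱ,𝒢)`-δ-scrambled n-tuple for `f`. -/
def Scrambled (f : X → X) (F G : Set (Set ℕ)) (δ : ℝ) {n : ℕ} (x : Fin n → X) : Prop :=
  Sset f x δ ∈ F ∧ ∀ ε > 0, Tset f x ε ∈ G

/-- `Y` is dense `(ℱ,𝒢)`-n-δ-chaotic for `f`: the `(ℱ,𝒢)`-δ-scrambled n-tuples in `Yⁿ`
form a dense subset of `Yⁿ`. -/
def DenseChaotic (f : X → X) (F G : Set (Set ℕ)) (n : ℕ) (δ : ℝ) (Y : Set X) : Prop :=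
  {x : Fin n → X | ∀ j, x j ∈ Y} ⊆
    closure {x : Fin n → X | (∀ j, x j ∈ Y) ∧ Scrambled f F G δ x}

/-- `S` is a residual subset of the subspace `T`: it contains a countable intersection of
dense open subsets of `T`. -/
def ResidualIn {α : Type*} [TopologicalSpace α] (T S : Set α) : Prop :=
  ∃ U : ℕ → Set α, (∀ i, IsOpen (U i)) ∧ (∀ i, T ⊆ closure (U i ∩ T)) ∧
    (⋂ i, U i) ∩ T ⊆ S

/-- `Y` is generic `(ℱ,𝒢)`-n-δ-chaotic for `f`: the `(ℱ,𝒢)`-δ-scrambled n-tuples in `Yⁿ`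
form a residual subset of `Yⁿ`. -/
def GenericChaotic (f : X → X) (F G : Set (Set ℕ)) (n : ℕ) (δ : ℝ) (Y : Set X) : Prop :=
  ResidualIn {x : Fin n → X | ∀ j, x j ∈ Y}
    {x : Fin n → X | (∀ j, x j ∈ Y) ∧ Scrambled f F G δ x}

/-- A Furstenberg family `F` is compatible with `(Z, g)`. -/
def CompatibleFamily {Z : Type*} [TopologicalSpace Z] (F : Set (Set ℕ)) (g : Z → Z) : Prop :=
  ∀ U : Set Z, IsOpen U → IsGδ {z | {i | g^[i] z ∈ U} ∈ F}

end Defs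

section ChainReach

variable {X : Type*} [MetricSpace X] {f : X → X}

theorem ChainIn.trans_univ {δ : ℝ} {k l : ℕ} {x y z : X} (h₁ : ChainIn f Set.univ δ k x y)
    (h₂ : ChainIn f Set.univ δ l y z) : ChainIn f Set.univ δ (k + l) x z := by
  obtain ⟨hk, a, ha0, hak, -, ha⟩ := h₁
  obtain ⟨hl, b, hb0, hbl, -, hb⟩ := h₂
  refine ⟨by omega, fun i => if i < k then a i else b (i - k), ?_, ?_, fun _ _ => trivial, ?_⟩
  · simp [show 0 < k by omega, ha0]
  · simp [hbl]
  · intro i hi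
    rcases lt_trichotomy (i + 1) k with h | h | h
    · simpa [h, show i < k by omega] using ha i (by omega)
    · have := ha i (by omega)
      rw [h, hak, ← hb0] at this
      simpa [h, show i < k by omega] using this
    · have := hb (i - k) (by omega)
      simpa [show ¬ i < k by omega, show ¬ i + 1 < k by omega,
        show i + 1 - k = i - k + 1 by omega] using this

theorem ChainReach.trans {x y z : X} (h₁ : ChainReach f x y) (h₂ : ChainReach f y z) :
    ChainReach f x z := fun δ hδ =>
  let ⟨_, hk⟩ := h₁ δ hδ
  let ⟨_, hl⟩ := h₂ δ hδ
  ⟨_, hk.trans_univ hl⟩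

theorem isClosed_setOf_chainReach_from (f : X → X) (x : X) :
    IsClosed {y | ChainReach f x y} := by
  refine isClosed_of_closure_subset fun z hz δ hδ => ?_
  obtain ⟨w, hw, hzw⟩ := Metric.mem_closure_iff.1 hz (δ / 2) (half_pos hδ)
  obtain ⟨k, hk, c, hc0, hck, -, hc⟩ := hw (δ / 2) (half_pos hδ)
  refine ⟨k, hk, Function.update c k z, ?_, by simp, fun _ _ => trivial, fun i hi => ?_⟩
  · rw [Function.update_of_ne (by omega), hc0]
  · have hci := hc i hi
    rw [Function.update_of_ne hi.ne]
    rcases eq_or_ne (i + 1) k with h | h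
    · rw [h, hck] at hci
      rw [h, Function.update_self]
      linarith [dist_triangle (f (c i)) w z, dist_comm z w]
    · rw [Function.update_of_ne h]
      linarith

theorem isClosed_setOf_chainReach_to (hf : Continuous f) (y : X) :
    IsClosed {x | ChainReach f x y} := by
  refine isClosed_of_closure_subset fun z hz δ hδ => ?_
  obtain ⟨η, hη, hfη⟩ := Metric.continuous_iff.1 hf z (δ / 2) (half_pos hδ)
  obtain ⟨w, hw, hzw⟩ := Metric.mem_closure_iff.1 hz η hη
  have hfw := hfη w (by rwa [dist_comm])
  obtain ⟨k, hk, c, hc0, hck, -, hc⟩ := hw (δ / 2) (half_pos hδ)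
  refine ⟨k, hk, Function.update c 0 z, by simp, ?_, fun _ _ => trivial, fun i hi => ?_⟩
  · rw [Function.update_of_ne (by omega), hck]
  · have hci := hc i hi
    rw [Function.update_of_ne (Nat.succ_ne_zero i)]
    rcases eq_or_ne i 0 with rfl | h
    · rw [hc0] at hci
      rw [Function.update_self]
      linarith [dist_triangle (f z) (f w) (c (0 + 1)), dist_comm (f z) (f w)]
    · rw [Function.update_of_ne h]
      linarith

theorem IsChainComponent.nonempty {C : Set X} (hC : IsChainComponent f C) : C.Nonempty := by
  obtain ⟨x, hx, rfl⟩ := hC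
  exact ⟨x, hx, hx, hx⟩

theorem IsChainComponent.isClosed (hf : Continuous f) {C : Set X}
    (hC : IsChainComponent f C) : IsClosed C := by
  obtain ⟨x, -, rfl⟩ := hC
  convert (isClosed_setOf_chainReach_from f x).inter (isClosed_setOf_chainReach_to hf x) using 1
  ext y
  exact ⟨fun h => h.2, fun h => ⟨h.2.trans h.1, h⟩⟩

theorem IsChainComponent.eq_setOf_of_mem {C : Set X} (hC : IsChainComponent f C) {z : X}
    (hz : z ∈ C) : C = {y | ChainRecurrent f y ∧ ChainReach f z y ∧ ChainReach f y z} := by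
  obtain ⟨x, -, rfl⟩ := hC
  obtain ⟨-, hxz, hzx⟩ := hz
  ext y
  exact ⟨fun h => ⟨h.1, hzx.trans h.2.1, h.2.2.trans hxz⟩,
    fun h => ⟨h.1, hxz.trans h.2.1, h.2.2.trans hzx⟩⟩

theorem IsChainComponent.disjoint {C C' : Set X} (hC : IsChainComponent f C)
    (hC' : IsChainComponent f C') (hne : C ≠ C') : Disjoint C C' :=
  Set.disjoint_left.2 fun _ hz hz' =>
    hne ((hC.eq_setOf_of_mem hz).trans (hC'.eq_setOf_of_mem hz').symm)

end ChainReach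

/-- points in the basins of distinct chain components form a distal pair. -/
theorem distal_of_distinct_chain_components
    {X : Type*} [MetricSpace X] [CompactSpace X] (f : X → X) (hf : Continuous f)
    (C C' : Set X) (hC : IsChainComponent f C) (hC' : IsChainComponent f C') (hne : C ≠ C')
    (x y : X) (hx : x ∈ wStable f C) (hy : y ∈ wStable f C') :
    0 < Filter.liminf (fun i => dist (f^[i] x) (f^[i] y)) atTop := by
  obtain ⟨δ, hδ, hdisj⟩ := (hC.disjoint hC' hne).exists_thickenings
    (hC.isClosed hf).isCompact (hC'.isClosed hf)
  refine (half_pos hδ).trans_le (le_liminf_of_le ?_ ?_)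
  · exact IsBoundedUnder.isCoboundedUnder_ge
      ⟨Metric.diam (Set.univ : Set X), Filter.eventually_map.2 (Eventually.of_forall fun i =>
        Metric.dist_le_diam_of_mem isCompact_univ.isBounded trivial trivial)⟩
  · filter_upwards [Tendsto.eventually_lt_const (half_pos hδ) hx,
      Tendsto.eventually_lt_const hδ hy] with i hix hiy
    by_contra! hlt
    refine Set.disjoint_left.1 hdisj (?_ : f^[i] y ∈ _) ?_
    · rw [Metric.mem_thickening_iff_infDist_lt hC.nonempty]
      have := Metric.infDist_le_infDist_add_dist (s := C) (x := f^[i] y) (y := f^[i] x)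
      rw [dist_comm] at this
      exact this.trans_lt (by linarith)
    · rwa [Metric.mem_thickening_iff_infDist_lt hC'.nonempty]
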